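/- If F and G are entire functions such that F − G is constant and there exist nonzero λ, μ ∈ ℂ and non-constant entire functions H, K with F = λ·e^H and G = μ·e^K, then F = G. -/

import Mathlib

open Complex

lemma aux_entire_log (f : ℂ → ℂ) (hf : Differentiable ℂ f) (h0 : ∀ z, f z ≠ 0) :
    ∃ p : ℂ → ℂ, Differentiable ℂ p ∧ ∀ z, f z = Complex.exp (p z) := by
  have hd : Differentiable ℂ (deriv f) := by
    have := (hf.contDiff (n := 2)).differentiable_deriv_two
    exact this
  have hq : Differentiable ℂ (fun z => deriv f z / f z) := hd.div hf h0
  obtain ⟨q, hq'⟩ := hq.isExactOn_univ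
  have hqd : ∀ z, HasDerivAt q (deriv f z / f z) z := fun z => hq' z (Set.mem_univ z)
  have hqD : Differentiable ℂ q := fun z => (hqd z).differentiableAt
  have hconst : ∀ z, f z * Complex.exp (-(q z)) = f 0 * Complex.exp (-(q 0)) := by
    intro z
    refine is_const_of_deriv_eq_zero (𝕜 := ℂ) (f := fun z => f z * Complex.exp (-(q z))) ?_ ?_ z 0
    · exact hf.mul hqD.neg.cexp
    · intro w
      have := ((hf w).hasDerivAt.mul (hqd w).neg.cexp).deriv
      refine Eq.trans this ?_
      have := h0 w
      field_simp
      ring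
  refine ⟨fun z => q z + Complex.log (f 0 * Complex.exp (-(q 0))), hqD.add_const _, ?_⟩
  intro z
  rw [Complex.exp_add, Complex.exp_log (mul_ne_zero (h0 0) (Complex.exp_ne_zero _)), ← hconst z,
    Complex.exp_neg]
  field_simp [Complex.exp_ne_zero]

lemma aux_bloch_local (f : ℂ → ℂ) (hf : Differentiable ℂ f) (a : ℂ) (r : ℝ) (hr : 0 < r)
    (ha : deriv f a ≠ 0) (hb : ∀ z ∈ Metric.ball a r, ‖deriv f z‖ ≤ 2 * ‖deriv f a‖) :
    Metric.ball (f a) (‖deriv f a‖ * r / 24) ⊆ Set.range f := by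
  have hd : Differentiable ℂ (deriv f) := (hf.contDiff (n := 2)).differentiable_deriv_two
  have hA : 0 < ‖deriv f a‖ := norm_pos_iff.mpr ha
  set A := ‖deriv f a‖ with hAdef
  have h1 : ∀ z ∈ Metric.ball a r, ‖deriv f z - deriv f a‖ ≤ 3 * A / r * ‖z - a‖ := by
    intro z hz
    have := Complex.dist_le_div_mul_dist_of_mapsTo_ball (f := deriv f) (c := a) (R₁ := r)
      (R₂ := 3 * A) hd.differentiableOn (fun w hw => by
        rw [mem_closedBall_iff_norm]
        have := norm_sub_le (deriv f w) (deriv f a)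
        have := hb w hw
        linarith) hz
    rwa [dist_eq_norm, dist_eq_norm] at this
  have h2 : ∀ z ∈ Metric.closedBall a (r / 6), ‖deriv f z - deriv f a‖ ≤ A / 2 := by
    intro z hz
    rw [mem_closedBall_iff_norm] at hz
    refine (h1 z (by rw [mem_ball_iff_norm]; linarith)).trans ?_
    calc 3 * A / r * ‖z - a‖ ≤ 3 * A / r * (r / 6) := by gcongr
      _ = A / 2 := by field_simp; norm_num
  have h3 : ∀ z ∈ Metric.closedBall a (r / 6),
      ‖(f z - deriv f a * z) - (f a - deriv f a * a)‖ ≤ A / 2 * ‖z - a‖ := by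
    intro z hz
    refine (convex_closedBall a (r / 6)).norm_image_sub_le_of_norm_hasDerivWithin_le
      (f := fun z => f z - deriv f a * z) (f' := fun z => deriv f z - deriv f a) ?_ h2
      (Metric.mem_closedBall_self (by positivity)) hz
    intro w _
    have := (hf w).hasDerivAt.sub ((hasDerivAt_id w).const_mul (deriv f a))
    simp only [mul_one] at this
    exact this.hasDerivWithinAt
  have h4 : ∀ z ∈ Metric.closedBall a (r / 6), A / 2 * ‖z - a‖ ≤ ‖f z - f a‖ := by
    intro z hz
    have e := h3 z hz
    have : deriv f a * (z - a) = (f z - f a) - ((f z - deriv f a * z) - (f a - deriv f a * a)) := by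
      ring
    have h := norm_sub_le (f z - f a) ((f z - deriv f a * z) - (f a - deriv f a * a))
    rw [← this, norm_mul, ← hAdef] at h
    linarith
  have h5 := (hf.diffContOnCl (s := Metric.ball a (r / 6))).ball_subset_image_closedBall
    (by positivity) (ε := A * r / 12) (fun z hz => by
      have := h4 z (Metric.sphere_subset_closedBall hz)
      rw [mem_sphere_iff_norm.mp hz] at this
      linarith) (by
      have : ∀ᶠ z in nhdsWithin a {a}ᶜ, f z ≠ f a := by
        filter_upwards [self_mem_nhdsWithin,
          nhdsWithin_le_nhds (Metric.closedBall_mem_nhds a (show 0 < r / 6 by positivity))] with z h1 h2 h3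
        have := h4 z h2
        rw [h3, sub_self, norm_zero] at this
        have : 0 < ‖z - a‖ := norm_pos_iff.mpr (sub_ne_zero.mpr h1)
        have : 0 < A / 2 * ‖z - a‖ := by positivity
        linarith
      exact this.frequently.filter_mono nhdsWithin_le_nhds)
  rw [show A * r / 24 = A * r / 12 / 2 by ring]
  exact h5.trans (Set.image_subset_range _ _)

lemma aux_bloch (f : ℂ → ℂ) (hf : Differentiable ℂ f) (a₀ : ℂ) (ha₀ : deriv f a₀ ≠ 0) (M : ℝ) :
    ∃ w, Metric.ball w M ⊆ Set.range f := by
  have hd : Differentiable ℂ (deriv f) := (hf.contDiff (n := 2)).differentiable_deriv_two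
  have hA : 0 < ‖deriv f a₀‖ := norm_pos_iff.mpr ha₀
  set R : ℝ := (|M| + 1) * 48 / ‖deriv f a₀‖ with hR
  have hR0 : 0 < R := by positivity
  obtain ⟨a, haR, hmax⟩ := (isCompact_closedBall a₀ R).exists_isMaxOn
    ⟨a₀, Metric.mem_closedBall_self hR0.le⟩
    (f := fun z => (R - ‖z - a₀‖) * ‖deriv f z‖) (by
      have := hd.continuous
      fun_prop)
  have hmax' : ∀ z ∈ Metric.closedBall a₀ R,
    (R - ‖z - a₀‖) * ‖deriv f z‖ ≤ (R - ‖a - a₀‖) * ‖deriv f a‖ := fun z hz => hmax hz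
  have hm0 := hmax' a₀ (Metric.mem_closedBall_self hR0.le)
  simp only [sub_self, norm_zero, sub_zero] at hm0
  have hRA : R * ‖deriv f a₀‖ = (|M| + 1) * 48 := by rw [hR]; field_simp
  rw [mem_closedBall_iff_norm] at haR
  have hpos : 0 < (R - ‖a - a₀‖) * ‖deriv f a‖ := by
    have : 0 < R * ‖deriv f a₀‖ := by positivity
    linarith
  have hne : deriv f a ≠ 0 := by
    intro h; simp [h] at hpos
  have hrp : 0 < R - ‖a - a₀‖ := pos_of_mul_pos_left hpos (norm_nonneg _)
  refine ⟨f a, (Metric.ball_subset_ball ?_).trans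
    (aux_bloch_local f hf a ((R - ‖a - a₀‖) / 2) (by positivity) hne ?_)⟩
  · have := le_abs_self M
    linarith
  · intro z hz
    rw [mem_ball_iff_norm] at hz
    have ht : ‖z - a₀‖ ≤ ‖z - a‖ + ‖a - a₀‖ := by
      have := norm_add_le (z - a) (a - a₀); simpa using this
    have h := hmax' z (by rw [mem_closedBall_iff_norm]; linarith)
    have h' : (R - ‖a - a₀‖) / 2 * ‖deriv f z‖ ≤ (R - ‖z - a₀‖) * ‖deriv f z‖ := by
      gcongr; linarith
    have h'' : (R - ‖a - a₀‖) * ‖deriv f z‖ ≤ (R - ‖a - a₀‖) * (2 * ‖deriv f a‖) := by linarith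
    exact le_of_mul_le_mul_left h'' hrp

lemma aux_cosh_gap_nonneg (x : ℝ) (hx : 0 ≤ x) :
    ∃ t : ℝ, |t - x| ≤ 2 ∧ ∃ n : ℤ, Real.cosh t = n := by
  have h2 : Real.cosh x + 1 ≤ Real.cosh (x + 2) := by
    have e1 : Real.cosh (x + 2) - Real.cosh x = 2 * Real.sinh (x + 1) * Real.sinh 1 := by
      rw [show x + 2 = (x + 1) + 1 by ring]
      have : Real.cosh x = Real.cosh ((x + 1) - 1) := by ring_nf
      rw [this, Real.cosh_add, Real.cosh_sub]; ring
    have e2 : (1 : ℝ) ≤ Real.sinh 1 := Real.self_le_sinh_iff.mpr zero_le_one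
    have e3 : x + 1 ≤ Real.sinh (x + 1) := Real.self_le_sinh_iff.mpr (by linarith)
    nlinarith
  have hc : (⌈Real.cosh x⌉ : ℝ) ∈ Set.Icc (Real.cosh x) (Real.cosh (x + 2)) :=
    ⟨Int.le_ceil _, by have := Int.ceil_lt_add_one (Real.cosh x); linarith⟩
  obtain ⟨t, ht, hte⟩ := intermediate_value_Icc (show x ≤ x + 2 by linarith)
    Real.continuous_cosh.continuousOn hc
  exact ⟨t, by rw [abs_le]; constructor <;> linarith [ht.1, ht.2], _, hte⟩

lemma aux_cosh_gap (x : ℝ) : ∃ t : ℝ, |t - x| ≤ 2 ∧ ∃ n : ℤ, Real.cosh t = n := by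
  rcases le_total 0 x with h | h
  · exact aux_cosh_gap_nonneg x h
  · obtain ⟨t, ht, n, hn⟩ := aux_cosh_gap_nonneg (-x) (by linarith)
    refine ⟨-t, ?_, n, by rw [Real.cosh_neg, hn]⟩
    rw [← abs_neg]; convert ht using 2; ring

lemma aux_net (w : ℂ) : ∃ q ∈ Metric.ball w 7, ∃ n : ℤ, Complex.cosh q = n := by
  obtain ⟨t, ht, n, hn⟩ := aux_cosh_gap w.re
  have hpi := Real.pi_pos
  set m : ℤ := round (w.im / Real.pi) with hm
  have hmb : |m * Real.pi - w.im| ≤ 4 := by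
    have h := abs_sub_round (w.im / Real.pi)
    rw [← hm] at h
    have e : m * Real.pi - w.im = -((w.im / Real.pi - m) * Real.pi) := by field_simp; ring
    rw [e, abs_neg, abs_mul, abs_of_pos hpi]
    have := Real.pi_lt_four
    nlinarith
  refine ⟨(t : ℂ) + ((m * Real.pi : ℝ) : ℂ) * I, ?_, ?_⟩
  · rw [mem_ball_iff_norm]
    refine (Complex.norm_le_abs_re_add_abs_im _).trans_lt ?_
    simp only [Complex.sub_re, Complex.add_re, Complex.ofReal_re, Complex.mul_re, Complex.I_re,
      Complex.ofReal_im, Complex.I_im, Complex.sub_im, Complex.add_im, Complex.mul_im, mul_zero,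
      mul_one, zero_mul, sub_zero, add_zero, zero_add]
    linarith
  · rw [Complex.cosh_add, Complex.cosh_mul_I, Complex.sinh_mul_I, ← Complex.ofReal_sin,
      ← Complex.ofReal_cos, Real.sin_int_mul_pi, Real.cos_int_mul_pi, ← Complex.ofReal_cosh, hn]
    rcases Int.even_or_odd m with h | h
    · exact ⟨n, by simp [h.neg_one_zpow]⟩
    · exact ⟨-n, by simp [h.neg_one_zpow]⟩

/-- An entire function omitting all integers is constant. -/
lemma aux_omit_int (g : ℂ → ℂ) (hg : Differentiable ℂ g) (h : ∀ z, ∀ n : ℤ, g z ≠ n) :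
    ∃ c, ∀ z, g z = c := by
  obtain ⟨s, hs, hse⟩ := aux_entire_log (fun z => g z ^ 2 - 1) ((hg.pow 2).sub_const 1) (by
    intro z hz
    have : (g z - 1) * (g z + 1) = 0 := by linear_combination hz
    rcases mul_eq_zero.mp this with h1 | h1
    · exact h z 1 (by push_cast; linear_combination h1)
    · exact h z (-1) (by push_cast; linear_combination h1))
  have hv : ∀ z, Complex.exp (s z / 2) ^ 2 = g z ^ 2 - 1 := by
    intro z
    rw [hse z, ← Complex.exp_nat_mul]; congr 1; push_cast; ring
  have hprod : ∀ z, (g z + Complex.exp (s z / 2)) * (g z - Complex.exp (s z / 2)) = 1 := by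
    intro z; linear_combination - hv z
  obtain ⟨p, hp, hpe⟩ := aux_entire_log (fun z => g z + Complex.exp (s z / 2))
    (hg.add (hs.div_const 2).cexp) (fun z hz => by
      have := hprod z
      rw [hz, zero_mul] at this
      exact zero_ne_one this)
  have hcosh : ∀ z, Complex.cosh (p z) = g z := by
    intro z
    have h1 := hpe z
    have h2 : Complex.exp (-(p z)) = g z - Complex.exp (s z / 2) := by
      rw [Complex.exp_neg, ← h1]
      exact inv_eq_of_mul_eq_one_right (hprod z)
    rw [Complex.cosh, h2, ← h1]; ring
  by_cases hc : ∀ z, deriv p z = 0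
  · exact ⟨g 0, fun z => by rw [← hcosh, ← hcosh, is_const_of_deriv_eq_zero hp hc z 0]⟩
  · push Not at hc
    obtain ⟨a, ha⟩ := hc
    obtain ⟨w, hw⟩ := aux_bloch p hp a ha 7
    obtain ⟨q, hq, n, hn⟩ := aux_net w
    obtain ⟨z, rfl⟩ := hw hq
    exact absurd ((hcosh z).symm.trans hn) (h z n)


/-- if `F − G` is constant, `F = λ·e^H`, `G = μ·e^K` with `H, K` non-constant
entire and `λ, μ ≠ 0`, then `F = G`. -/
theorem const_difference_of_exps
    (F G H K : ℂ → ℂ) (lam mu : ℂ)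
    (hH : Differentiable ℂ H) (hK : Differentiable ℂ K)
    (hlam : lam ≠ 0) (hmu : mu ≠ 0)
    (hncH : ¬ ∃ c : ℂ, ∀ z, H z = c)
    (hncK : ¬ ∃ c : ℂ, ∀ z, K z = c)
    (hFc : ∃ c : ℂ, ∀ z, F z - G z = c)
    (hFe : ∀ z, F z = lam * Complex.exp (H z))
    (hGe : ∀ z, G z = mu * Complex.exp (K z)) :
    F = G := by
  obtain ⟨c, hc⟩ := hFc
  by_cases hc0 : c = 0
  · funext z
    exact sub_eq_zero.mp ((hc z).trans hc0)
  exfalso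
  apply hncH
  have hpi : (2 * Real.pi * I : ℂ) ≠ 0 := Complex.two_pi_I_ne_zero
  obtain ⟨d, hd⟩ := aux_omit_int (fun z => (H z + Complex.log (lam / c)) / (2 * Real.pi * I))
    ((hH.add_const _).div_const _) (by
      intro z n hn
      have h1 : H z + Complex.log (lam / c) = n * (2 * Real.pi * I) := (div_eq_iff hpi).mp hn
      have h2 := congrArg Complex.exp h1
      rw [Complex.exp_add, Complex.exp_log (div_ne_zero hlam hc0),
        Complex.exp_int_mul_two_pi_mul_I] at h2
      have h3 : lam * Complex.exp (H z) = c := by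
        field_simp at h2
        linear_combination h2
      have h4 := hc z
      rw [hFe, hGe, h3] at h4
      exact mul_ne_zero hmu (Complex.exp_ne_zero (K z)) (by linear_combination -h4))
  refine ⟨d * (2 * Real.pi * I) - Complex.log (lam / c), fun z => ?_⟩
  have := (div_eq_iff hpi).mp (hd z)
  linear_combination this
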